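/- Let m be a positive integer, q ∈ [q_f(m), m+1], and let c, d ∈ A'_q satisfy f_{c,d}(q) ≤ 0. Then there exists a unique q_{c,d} ∈ [q, m+1] such that f_{c,d}(q_{c,d}) = 0, and this q_{c,d} belongs to B_2(m). -/

import Mathlib

/-- A sequence of digits has a last nonzero digit. -/
def hasLastNonzero (c : ℕ → ℕ) : Prop := ∃ n, c n ≠ 0 ∧ ∀ i > n, c i = 0

/-- `c` (with `c i` the `(i+1)`-st digit) is a `q`-expansion of `x`
with respect to the digit set `Ω_m = {0,1,…,m}`. -/
def isExpansion (m : ℕ) (q : ℝ) (x : ℝ) (c : ℕ → ℕ) : Prop :=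
  (∀ i, c i ≤ m) ∧ x = ∑' i : ℕ, (c i : ℝ) / q ^ (i + 1)

/-- The set `U_q` of points of `I_q = [0, m/(q-1)]` with a unique `q`-expansion. -/
def Uq (m : ℕ) (q : ℝ) : Set ℝ :=
  {x | x ∈ Set.Icc 0 ((m : ℝ) / (q - 1)) ∧ ∃! c, isExpansion m q x c}

/-- The set `U'_q` of digit sequences that are unique `q`-expansions. -/
def Uq' (m : ℕ) (q : ℝ) : Set (ℕ → ℕ) :=
  {c | isExpansion m q (∑' i : ℕ, (c i : ℝ) / q ^ (i + 1)) c ∧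
       ∀ d, isExpansion m q (∑' i : ℕ, (c i : ℝ) / q ^ (i + 1)) d → d = c}

/-- `B_2(m)`: bases `q ∈ (1, m+1]` for which some `x ∈ I_q` has exactly two
different `q`-expansions. -/
def B2 (m : ℕ) : Set ℝ :=
  {q | q ∈ Set.Ioc 1 ((m : ℝ) + 1) ∧
    ∃ x ∈ Set.Icc (0 : ℝ) ((m : ℝ) / (q - 1)), ∃ a b : ℕ → ℕ,
      a ≠ b ∧ isExpansion m q x a ∧ isExpansion m q x b ∧
      ∀ c, isExpansion m q x c → c = a ∨ c = b}

/-- Strict lexicographic order on digit sequences. -/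
def lexLt (a b : ℕ → ℕ) : Prop := ∃ n, (∀ i < n, a i = b i) ∧ a n < b n

/-- Lexicographic order on digit sequences. -/
def lexLe (a b : ℕ → ℕ) : Prop := lexLt a b ∨ a = b

/-- `a` is the quasi-greedy `q`-expansion of `1`: the lexicographically largest
`q`-expansion of `1` without a last nonzero digit. -/
def isQuasiGreedy (m : ℕ) (q : ℝ) (a : ℕ → ℕ) : Prop :=
  isExpansion m q 1 a ∧ ¬ hasLastNonzero a ∧
  ∀ b, isExpansion m q 1 b → ¬ hasLastNonzero b → lexLe b a

/-- `A'_q = {(c_i) ∈ U'_q : c_1 < α_1(q)}`. -/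
def Aq' (m : ℕ) (q : ℝ) : Set (ℕ → ℕ) :=
  {c | c ∈ Uq' m q ∧ ∀ a, isQuasiGreedy m q a → c 0 < a 0}

/-- `f_{c,d}(t) = (m+1)/t + Σ_{i≥1} (c_i + d_i) t^{-(i+1)} - m/(t-1)`. -/
noncomputable def fcd (m : ℕ) (c d : ℕ → ℕ) (t : ℝ) : ℝ :=
  ((m : ℝ) + 1) / t + (∑' i : ℕ, ((c i : ℝ) + (d i : ℝ)) / t ^ (i + 2)) - (m : ℝ) / (t - 1)

/-- `x = q_f(m)`: the largest real root of `q³-(k+2)q²+q-(k+1)=0` if `m = 2k+1`,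
and of `q²-(k+1)q-k=0` if `m = 2k`. -/
def isQf (m : ℕ) (x : ℝ) : Prop :=
  (∃ k : ℕ, m = 2 * k + 1 ∧
    x ^ 3 - ((k : ℝ) + 2) * x ^ 2 + x - ((k : ℝ) + 1) = 0 ∧
    ∀ y : ℝ, y ^ 3 - ((k : ℝ) + 2) * y ^ 2 + y - ((k : ℝ) + 1) = 0 → y ≤ x) ∨
  (∃ k : ℕ, m = 2 * k ∧
    x ^ 2 - ((k : ℝ) + 1) * x - (k : ℝ) = 0 ∧
    ∀ y : ℝ, y ^ 2 - ((k : ℝ) + 1) * y - (k : ℝ) = 0 → y ≤ x)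

/-- A doubly infinite sequence: neither it nor its reflection has a last nonzero digit. -/
def doublyInfinite (m : ℕ) (c : ℕ → ℕ) : Prop :=
  ¬ hasLastNonzero c ∧ ¬ hasLastNonzero (fun i => m - c i)

/-- `V_q`: points of `I_q` with at most one doubly infinite `q`-expansion. -/
def Vq (m : ℕ) (q : ℝ) : Set ℝ :=
  {x | x ∈ Set.Icc 0 ((m : ℝ) / (q - 1)) ∧
    ∀ a b : ℕ → ℕ, isExpansion m q x a → isExpansion m q x b →
      doublyInfinite m a → doublyInfinite m b → a = b}

/-- `U = {q ∈ (1, m+1] : 1 ∈ U_q}`. -/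
def Uset (m : ℕ) : Set ℝ := {q | q ∈ Set.Ioc 1 ((m : ℝ) + 1) ∧ (1 : ℝ) ∈ Uq m q}

/-- `V = {q ∈ (1, m+1] : 1 ∈ V_q}`. -/
def Vset (m : ℕ) : Set ℝ := {q | q ∈ Set.Ioc 1 ((m : ℝ) + 1) ∧ (1 : ℝ) ∈ Vq m q}

/-- The generalized golden ratio `G(m)`. -/
noncomputable def Gratio (m : ℕ) : ℝ :=
  if m % 2 = 0 then ((m / 2 : ℕ) : ℝ) + 1
  else (((m / 2 : ℕ) : ℝ) + 1 +
    Real.sqrt (((m / 2 : ℕ) : ℝ) ^ 2 + 6 * ((m / 2 : ℕ) : ℝ) + 5)) / 2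

/-- The set of accumulation points of a set of reals. -/
def accPts (S : Set ℝ) : Set ℝ := {x | AccPt x (Filter.principal S)}

/-- Iterated accumulation-point sets `B_2^{(i)}(m)`. -/
def B2iter (m : ℕ) : ℕ → Set ℝ
  | 0 => B2 m
  | n + 1 => accPts (B2iter m n)

/-- The value `∑ c_i q^{-(i+1)}` of a digit sequence in base `q`. -/
noncomputable def expVal (q : ℝ) (c : ℕ → ℕ) : ℝ := ∑' i : ℕ, (c i : ℝ) / q ^ (i + 1)

/-- The digit sequence with first digit `a` followed by `e`. -/
def consDigit (a : ℕ) (e : ℕ → ℕ) : ℕ → ℕ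
  | 0 => a
  | i + 1 => e i

section expVal

variable {m : ℕ} {q : ℝ} {c : ℕ → ℕ}

lemma consDigit_le {a : ℕ} {e : ℕ → ℕ} (ha : a ≤ m) (he : ∀ i, e i ≤ m) (i : ℕ) :
    consDigit a e i ≤ m := by
  cases i with
  | zero => exact ha
  | succ i => exact he i

lemma hasSum_const_div_pow (hq : 1 < q) (a : ℝ) :
    HasSum (fun i : ℕ => a / q ^ (i + 1)) (a / (q - 1)) := by
  have h := (hasSum_geometric_of_lt_one (r := q⁻¹) (by positivity)
    (inv_lt_one_of_one_lt₀ hq)).mul_left (a / q)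
  have hq1 : q - 1 ≠ 0 := by linarith
  have hterm : (fun i : ℕ => a / q ^ (i + 1)) = fun i => a / q * q⁻¹ ^ i := by
    ext i
    rw [pow_succ, inv_pow]
    field_simp
  have hlim : a / (q - 1) = a / q * (1 - q⁻¹)⁻¹ := by
    have : 1 - q⁻¹ = (q - 1) / q := by field_simp
    rw [this]
    field_simp
  rwa [hterm, hlim]

lemma summable_expVal (hq : 1 < q) (hc : ∀ i, c i ≤ m) :
    Summable fun i : ℕ => (c i : ℝ) / q ^ (i + 1) := by
  refine Summable.of_nonneg_of_le (fun i => by positivity) (fun i => ?_)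
    (hasSum_const_div_pow hq (m : ℝ)).summable
  have : (c i : ℝ) ≤ m := by exact_mod_cast hc i
  gcongr

lemma expVal_nonneg (hq : 1 < q) (c : ℕ → ℕ) : 0 ≤ expVal q c :=
  tsum_nonneg fun i => by positivity

lemma expVal_le (hq : 1 < q) (hc : ∀ i, c i ≤ m) : expVal q c ≤ m / (q - 1) := by
  refine hasSum_le (fun i => ?_) (summable_expVal hq hc).hasSum (hasSum_const_div_pow hq (m : ℝ))
  have : (c i : ℝ) ≤ m := by exact_mod_cast hc i
  gcongr

lemma expVal_reflect (hq : 1 < q) (hc : ∀ i, c i ≤ m) :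
    expVal q (fun i => m - c i) = m / (q - 1) - expVal q c := by
  rw [expVal, expVal, ← (hasSum_const_div_pow hq (m : ℝ)).tsum_eq,
    ← (hasSum_const_div_pow hq (m : ℝ)).summable.tsum_sub (summable_expVal hq hc)]
  refine tsum_congr fun i => ?_
  rw [Nat.cast_sub (hc i), sub_div]

lemma mul_expVal (hq : 1 < q) (hc : ∀ i, c i ≤ m) :
    q * expVal q c = c 0 + expVal q (fun i => c (i + 1)) := by
  have h := (summable_expVal hq hc).tsum_eq_zero_add
  have h2 : expVal q (fun i => c (i + 1)) = q * ∑' i : ℕ, (c (i + 1) : ℝ) / q ^ (i + 1 + 1) := by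
    rw [← tsum_mul_left]
    refine tsum_congr fun i => ?_
    rw [pow_succ q (i + 1)]
    field_simp
  rw [expVal, h, h2]
  field_simp
  ring

lemma mul_expVal_shift (hq : 1 < q) (hc : ∀ i, c i ≤ m) (n : ℕ) :
    q * expVal q (fun i => c (i + n)) = c n + expVal q (fun i => c (i + (n + 1))) := by
  rw [mul_expVal hq (c := fun i => c (i + n)) fun i => hc _, zero_add]
  simp only [add_assoc, add_comm 1 n]

lemma expVal_antitone {p : ℝ} (hq : 1 < q) (hqp : q ≤ p) (hc : ∀ i, c i ≤ m) :
    expVal p c ≤ expVal q c := by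
  refine (summable_expVal (hq.trans_le hqp) hc).tsum_le_tsum (fun i => ?_) (summable_expVal hq hc)
  gcongr

lemma continuousOn_expVal (hq : 1 < q) (hc : ∀ i, c i ≤ m) :
    ContinuousOn (fun t => expVal t c) (Set.Ici q) := by
  refine continuousOn_tsum (u := fun i => (m : ℝ) / q ^ (i + 1)) (fun i => ?_)
    (hasSum_const_div_pow hq (m : ℝ)).summable fun i t ht => ?_
  · refine ContinuousOn.div continuousOn_const (by fun_prop) fun t ht => ?_
    have : 0 < t := by linarith [Set.mem_Ici.1 ht]
    positivity
  · have ht' : q ≤ t := ht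
    have : 0 < t := by linarith
    have : (c i : ℝ) ≤ m := by exact_mod_cast hc i
    rw [Real.norm_of_nonneg (by positivity)]
    gcongr

/-- A sequence of digits produced by a bounded sequence of remainders is an expansion of the
initial remainder. -/
lemma expVal_eq_of_remainders (hq : 1 < q) (hc : ∀ i, c i ≤ m) {r : ℕ → ℝ} {B : ℝ}
    (hr : ∀ n, |r n| ≤ B) (hrec : ∀ n, r (n + 1) = q * r n - c n) : expVal q c = r 0 := by
  have hsum : ∀ n, ∑ i ∈ Finset.range n, (c i : ℝ) / q ^ (i + 1) = r 0 - r n / q ^ n := by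
    intro n
    induction n with
    | zero => simp
    | succ n ih =>
      rw [Finset.sum_range_succ, ih, hrec]
      field_simp
      ring
  have hlim : Filter.Tendsto (fun n => r n / q ^ n) Filter.atTop (nhds 0) := by
    have h1 : Filter.Tendsto (fun n : ℕ => B * (q⁻¹) ^ n) Filter.atTop (nhds 0) := by
      simpa using (tendsto_pow_atTop_nhds_zero_of_lt_one (r := q⁻¹) (by positivity)
        (inv_lt_one_of_one_lt₀ hq)).const_mul B
    refine squeeze_zero_norm (fun n => ?_) h1
    rw [norm_div, norm_pow, Real.norm_eq_abs, Real.norm_of_nonneg (by linarith : 0 ≤ q), inv_pow,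
      div_eq_mul_inv]
    gcongr
    exact hr n
  have h2 := (summable_expVal hq hc).hasSum.tendsto_sum_nat
  simp only [hsum] at h2
  have h3 := hlim.const_sub (r 0)
  rw [sub_zero] at h3
  exact tendsto_nhds_unique h2 h3

lemma exists_isExpansion (hq : 1 < q) (hqm : q ≤ m + 1) {y : ℝ} (hy0 : 0 ≤ y)
    (hy : y ≤ m / (q - 1)) : ∃ e, isExpansion m q y e := by
  let step : ℝ → ℝ := fun r => q * r - (min m ⌊q * r⌋₊ : ℕ)
  let r : ℕ → ℝ := fun n => step^[n] y
  have hq1 : 0 < q - 1 := by linarith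
  have hM : 1 ≤ (m : ℝ) / (q - 1) := by
    rw [le_div_iff₀ hq1]
    linarith
  have hsucc : ∀ n, r (n + 1) = q * r n - (min m ⌊q * r n⌋₊ : ℕ) := fun n =>
    Function.iterate_succ_apply' step n y
  have hr : ∀ n, 0 ≤ r n ∧ r n ≤ m / (q - 1) := by
    intro n
    induction n with
    | zero => exact ⟨hy0, hy⟩
    | succ n ih =>
      have hnn : 0 ≤ q * r n := mul_nonneg (by linarith) ih.1
      rw [hsucc]
      have hfl := Nat.floor_le hnn
      rcases le_total ⌊q * r n⌋₊ m with h | h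
      · rw [min_eq_right h]
        have := Nat.lt_floor_add_one (q * r n)
        constructor <;> linarith
      · rw [min_eq_left h]
        have hcast : (m : ℝ) ≤ (⌊q * r n⌋₊ : ℕ) := by exact_mod_cast h
        refine ⟨by linarith, ?_⟩
        have h1 : q * r n ≤ q * (m / (q - 1)) := by gcongr; exact ih.2
        have h2 : q * ((m : ℝ) / (q - 1)) = m + m / (q - 1) := by field_simp; ring
        linarith
  have hd : ∀ n, min m ⌊q * r n⌋₊ ≤ m := fun n => min_le_left _ _
  refine ⟨fun n => min m ⌊q * r n⌋₊, hd, ?_⟩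
  exact (expVal_eq_of_remainders hq hd (r := r) (B := m / (q - 1))
    (fun n => abs_le.2 ⟨by linarith [(hr n).1, (hr n).2], (hr n).2⟩) hsucc).symm

lemma isExpansion_iff {x : ℝ} : isExpansion m q x c ↔ (∀ i, c i ≤ m) ∧ expVal q c = x :=
  and_congr_right fun _ => eq_comm

lemma mem_Uq'_iff : c ∈ Uq' m q ↔
    (∀ i, c i ≤ m) ∧ ∀ d : ℕ → ℕ, (∀ i, d i ≤ m) → expVal q d = expVal q c → d = c := by
  constructor
  · exact fun h => ⟨h.1.1, fun d hd hv => h.2 d ⟨hd, hv.symm⟩⟩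
  · exact fun h => ⟨⟨h.1, rfl⟩, fun d hd => h.2 d hd.1 hd.2.symm⟩

lemma mul_expVal_consDigit (hq : 1 < q) {a : ℕ} {e : ℕ → ℕ} (ha : a ≤ m)
    (he : ∀ i, e i ≤ m) : q * expVal q (consDigit a e) = a + expVal q e :=
  mul_expVal hq (consDigit_le ha he)

lemma expVal_shift_mem_Uq' (hq : 1 < q) (hc : c ∈ Uq' m q) (n : ℕ) :
    (fun i => c (i + n)) ∈ Uq' m q := by
  induction n with
  | zero => exact hc
  | succ n ih =>
    rw [mem_Uq'_iff] at ih ⊢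
    have hle : ∀ i, c i ≤ m := hc.1.1
    refine ⟨fun i => hle _, fun d hd hv => ?_⟩
    have h := ih.2 (consDigit (c n) d) (consDigit_le (hle n) hd) ?_
    · ext i
      have := congrFun h (i + 1)
      simpa [consDigit, add_assoc, add_comm 1 n] using this
    · have h1 := mul_expVal_consDigit hq (hle n) hd
      have h2 := mul_expVal_shift hq hle n
      have : q ≠ 0 := by linarith
      exact mul_left_cancel₀ this (by rw [h1, h2, hv])

lemma expVal_tail_lt_one (hq : 1 < q) (hqm : q ≤ m + 1) (hc : c ∈ Uq' m q) {n : ℕ}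
    (hn : c n < m) : expVal q (fun i => c (i + (n + 1))) < 1 := by
  by_contra! hge
  have hle : ∀ i, c i ≤ m := hc.1.1
  have hub : expVal q (fun i => c (i + (n + 1))) ≤ m / (q - 1) := expVal_le hq fun i => hle _
  obtain ⟨e, he⟩ := exists_isExpansion hq hqm
    (y := expVal q (fun i => c (i + (n + 1))) - 1) (by linarith) (by linarith)
  rw [isExpansion_iff] at he
  have h := (mem_Uq'_iff.1 (expVal_shift_mem_Uq' hq hc n)).2 (consDigit (c n + 1) e)
    (consDigit_le hn he.1) ?_
  · have := congrFun h 0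
    simp [consDigit] at this
  · have h1 := mul_expVal_consDigit hq (a := c n + 1) hn he.1
    have h2 := mul_expVal_shift hq hle n
    have : q ≠ 0 := by linarith
    refine mul_left_cancel₀ this ?_
    rw [h1, h2, he.2]
    push_cast
    ring

lemma reflect_mem_Uq' (hq : 1 < q) (hc : c ∈ Uq' m q) : (fun i => m - c i) ∈ Uq' m q := by
  rw [mem_Uq'_iff] at hc ⊢
  refine ⟨fun i => Nat.sub_le _ _, fun d hd hv => ?_⟩
  have h := hc.2 (fun i => m - d i) (fun i => Nat.sub_le _ _) (by
    rw [expVal_reflect hq hd, hv, expVal_reflect hq hc.1]; ring)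
  ext i
  have h1 := congrFun h i
  have h2 := hd i
  omega

lemma expVal_reflect_tail_lt_one (hq : 1 < q) (hqm : q ≤ m + 1) (hc : c ∈ Uq' m q) {n : ℕ}
    (hn : 0 < c n) : expVal q (fun i => m - c (i + (n + 1))) < 1 := by
  have hle : ∀ i, c i ≤ m := hc.1.1
  refine expVal_tail_lt_one hq hqm (reflect_mem_Uq' hq hc) (n := n) ?_
  have := hle n
  omega

lemma mem_Uq'_of_tails (hq : 1 < q) (hle : ∀ i, c i ≤ m)
    (h1 : ∀ n, c n < m → expVal q (fun i => c (i + (n + 1))) < 1)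
    (h2 : ∀ n, 0 < c n → expVal q (fun i => m - c (i + (n + 1))) < 1) : c ∈ Uq' m q := by
  rw [mem_Uq'_iff]
  refine ⟨hle, fun d hd hv => ?_⟩
  have key : ∀ n, expVal q (fun i => d (i + n)) = expVal q (fun i => c (i + n)) → d n = c n := by
    intro n hn
    have hcn := mul_expVal_shift hq hle n
    have hdn := mul_expVal_shift hq hd n
    rw [hn, hcn] at hdn
    rcases lt_trichotomy (d n) (c n) with h | h | h
    · exfalso
      have h3 := h2 n (by omega)
      have h4 := expVal_reflect hq (m := m) (c := fun i => c (i + (n + 1))) fun i => hle _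
      have h5 := expVal_le hq (m := m) (c := fun i => d (i + (n + 1))) fun i => hd _
      have h6 : (d n : ℝ) + 1 ≤ c n := by exact_mod_cast h
      linarith
    · exact h
    · exfalso
      have h3 := h1 n (h.trans_le (hd n))
      have h5 := expVal_nonneg hq (fun i => d (i + (n + 1)))
      have h6 : (c n : ℝ) + 1 ≤ d n := by exact_mod_cast h
      linarith
  have tails : ∀ n, expVal q (fun i => d (i + n)) = expVal q (fun i => c (i + n)) := by
    intro n
    induction n with
    | zero => exact hv
    | succ n ih =>
      have hcn := mul_expVal_shift hq hle n
      have hdn := mul_expVal_shift hq hd n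
      rw [ih, key n ih, hcn] at hdn
      linarith
  exact funext fun n => key n (tails n)

lemma Uq'_mono {p : ℝ} (hq : 1 < q) (hqp : q ≤ p) (hp : p ≤ m + 1) : Uq' m q ⊆ Uq' m p := by
  intro c hc
  have hle : ∀ i, c i ≤ m := hc.1.1
  refine mem_Uq'_of_tails (hq.trans_le hqp) hle (fun n hn => ?_) fun n hn => ?_
  · exact (expVal_antitone hq hqp fun i => hle _).trans_lt
      (expVal_tail_lt_one hq (hqp.trans hp) hc hn)
  · exact (expVal_antitone (m := m) hq hqp fun i => Nat.sub_le _ _).trans_lt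
      (expVal_reflect_tail_lt_one hq (hqp.trans hp) hc hn)

lemma hasLastNonzero_of_tail_eq_zero {b : ℕ → ℕ} {n : ℕ} (hn : b n ≠ 0)
    (h : ∀ i, b (i + (n + 1)) = 0) : hasLastNonzero b := by
  refine ⟨n, hn, fun i hi => ?_⟩
  have := h (i - (n + 1))
  rwa [Nat.sub_add_cancel hi] at this

lemma eq_zero_of_expVal_nonpos (hq : 1 < q) (hc : ∀ i, c i ≤ m) (h : expVal q c ≤ 0) (i : ℕ) :
    c i = 0 := by
  have h1 := (summable_expVal hq hc).le_tsum i fun j _ => by positivity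
  have h2 : (c i : ℝ) / q ^ (i + 1) ≤ 0 := h1.trans h
  by_contra hne
  have : (0 : ℝ) < c i := by exact_mod_cast Nat.pos_of_ne_zero hne
  have : 0 < (c i : ℝ) / q ^ (i + 1) := by positivity
  linarith

lemma exists_isQuasiGreedy (hq : 1 < q) (hqm : q ≤ m + 1) :
    ∃ a, isQuasiGreedy m q a ∧ (a 0 : ℝ) < q := by
  let step : ℝ → ℝ := fun r => q * r - (⌈q * r⌉₊ - 1 : ℕ)
  let r : ℕ → ℝ := fun n => step^[n] 1
  have hsucc : ∀ n, r (n + 1) = q * r n - (⌈q * r n⌉₊ - 1 : ℕ) := fun n =>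
    Function.iterate_succ_apply' step n 1
  have hceil : ∀ x : ℝ, 0 < x → (((⌈x⌉₊ - 1 : ℕ) : ℝ) < x ∧ x ≤ ((⌈x⌉₊ - 1 : ℕ) : ℝ) + 1) := by
    intro x hx
    have h1 := Nat.ceil_pos.2 hx
    have h2 := Nat.ceil_lt_add_one hx.le
    have h3 := Nat.le_ceil x
    rw [Nat.cast_sub h1, Nat.cast_one]
    constructor <;> linarith
  have hr : ∀ n, 0 < r n ∧ r n ≤ 1 := by
    intro n
    induction n with
    | zero => exact ⟨one_pos, le_rfl⟩
    | succ n ih =>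
      have h := hceil (q * r n) (mul_pos (by linarith) ih.1)
      rw [hsucc]
      constructor <;> linarith
  have hpos : ∀ n, 0 < q * r n := fun n => mul_pos (by linarith) (hr n).1
  let a : ℕ → ℕ := fun n => ⌈q * r n⌉₊ - 1
  have ha : ∀ n, a n ≤ m := by
    intro n
    have h1 : q * r n ≤ (m + 1 : ℕ) := by
      push_cast
      nlinarith [(hr n).1, (hr n).2]
    have := Nat.ceil_le.2 h1
    simp only [a]
    omega
  have hval : ∀ n, expVal q (fun i => a (i + n)) = r n := by
    intro n
    have := expVal_eq_of_remainders hq (fun i => ha (i + n)) (r := fun i => r (i + n)) (B := 1)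
      (fun i => abs_le.2 ⟨by linarith [(hr (i + n)).1], (hr (i + n)).2⟩)
      (fun i => by rw [add_right_comm]; exact hsucc _)
    simpa using this
  refine ⟨a, ⟨⟨ha, (hval 0).symm⟩, ?_, fun b hb hbn => ?_⟩, ?_⟩
  · rintro ⟨n, -, hn⟩
    have h1 : expVal q (fun i => a (i + (n + 1))) = 0 := by
      have : (fun i => a (i + (n + 1))) = fun _ => 0 := funext fun i => hn _ (by omega)
      rw [this]
      simp [expVal]
    linarith [hval (n + 1), (hr (n + 1)).1]
  · by_cases hba : b = a
    · exact Or.inr hba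
    left
    have hex : ∃ n, b n ≠ a n := by
      by_contra! h
      exact hba (funext h)
    classical
    let n := Nat.find hex
    have hlt : ∀ i < n, b i = a i := fun i hi => not_not.1 (Nat.find_min hex hi)
    refine ⟨n, hlt, lt_of_le_of_ne ?_ (Nat.find_spec hex)⟩
    have tails : ∀ k ≤ n, expVal q (fun i => b (i + k)) = r k := by
      intro k
      induction k with
      | zero => exact fun _ => hb.2.symm
      | succ k ih =>
        intro hk
        have h1 := mul_expVal_shift hq hb.1 k
        rw [ih (by omega), hlt k hk] at h1
        rw [hsucc]
        linarith
    by_contra! hgt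
    have h1 := mul_expVal_shift hq hb.1 n
    have h2 : (a n : ℝ) + 1 ≤ b n := by exact_mod_cast hgt
    have h3 : q * r n ≤ a n + 1 := (hceil _ (hpos n)).2
    rw [tails n le_rfl] at h1
    refine hbn (hasLastNonzero_of_tail_eq_zero (n := n) (by omega) ?_)
    exact eq_zero_of_expVal_nonpos hq (fun i => hb.1 _) (by linarith)
  · have := (hceil _ (hpos 0)).1
    simpa [a, r] using this

lemma first_digit_lt_of_mem_Aq' (hq : 1 < q) (hqm : q ≤ m + 1) (hc : c ∈ Aq' m q) :
    (c 0 : ℝ) + 1 < q := by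
  obtain ⟨a, ha, haq⟩ := exists_isQuasiGreedy hq hqm
  have : (c 0 : ℝ) + 1 ≤ a 0 := by exact_mod_cast hc.2 a ha
  linarith

lemma expVal_lt_one_of_mem_Aq' (hq : 1 < q) (hqm : q ≤ m + 1) (hc : c ∈ Aq' m q) :
    expVal q c < 1 := by
  by_contra! hge
  have hle : ∀ i, c i ≤ m := hc.1.1.1
  have h0 := first_digit_lt_of_mem_Aq' hq hqm hc
  have h0m : c 0 < m := by
    have : (c 0 : ℝ) < m := by linarith
    exact_mod_cast this
  have h1 := mul_expVal hq hle
  have h2 := expVal_tail_lt_one hq hqm hc.1 h0m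
  simp only [zero_add] at h2
  nlinarith

lemma mul_fcd {d : ℕ → ℕ} (hq : 1 < q) (hc : ∀ i, c i ≤ m) (hd : ∀ i, d i ≤ m) :
    q * fcd m c d q = 1 + expVal q c + expVal q d - m / (q - 1) := by
  have h : ∑' i : ℕ, ((c i : ℝ) + (d i : ℝ)) / q ^ (i + 2) = (expVal q c + expVal q d) / q := by
    rw [expVal, expVal, ← (summable_expVal hq hc).tsum_add (summable_expVal hq hd),
      ← tsum_div_const]
    refine tsum_congr fun i => ?_
    rw [pow_succ q (i + 1)]
    field_simp
  have hq1 : q - 1 ≠ 0 := by linarith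
  rw [fcd, h]
  field_simp
  ring

lemma fcd_eq_zero_iff {d : ℕ → ℕ} (hq : 1 < q) (hc : ∀ i, c i ≤ m) (hd : ∀ i, d i ≤ m) :
    fcd m c d q = 0 ↔ 1 + expVal q c + expVal q d - m / (q - 1) = 0 := by
  rw [← mul_fcd hq hc hd, mul_eq_zero, or_iff_right (by linarith)]

end expVal

/-- A zero of `f_{c,d}` makes `1c` and `0` followed by the reflection of `d` the only two
expansions of the same number. -/
lemma mem_B2_of_zero {m : ℕ} (hm : 0 < m) {p : ℝ} (hp : 1 < p) (hpm : p ≤ m + 1)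
    {c d : ℕ → ℕ} (hc : c ∈ Uq' m p) (hd : d ∈ Uq' m p) (hc1 : expVal p c < 1)
    (h : 1 + expVal p c + expVal p d - m / (p - 1) = 0) : p ∈ B2 m := by
  have hd' := reflect_mem_Uq' hp hd
  have hp0 : p ≠ 0 := by linarith
  have ha : ∀ i, consDigit 1 c i ≤ m := consDigit_le hm hc.1.1
  have hb : ∀ i, consDigit 0 (fun i => m - d i) i ≤ m := consDigit_le hm.le hd'.1.1
  have hav := mul_expVal_consDigit hp (a := 1) hm hc.1.1
  have hbv := mul_expVal_consDigit hp (a := 0) hm.le hd'.1.1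
  have hdv := expVal_reflect hp hd.1.1
  push_cast at hav hbv
  refine ⟨⟨hp, hpm⟩, expVal p (consDigit 1 c), ⟨expVal_nonneg hp _, expVal_le hp ha⟩,
    consDigit 1 c, consDigit 0 (fun i => m - d i), fun hab => ?_, ⟨ha, rfl⟩, ⟨hb, ?_⟩, fun e he => ?_⟩
  · exact absurd (congrFun hab 0) one_ne_zero
  · exact mul_left_cancel₀ hp0 (by change _ = p * expVal p _; linarith)
  · rw [isExpansion_iff] at he
    have hev := mul_expVal hp he.1
    rw [he.2, hav] at hev
    have hcons : ∀ {s : ℕ → ℕ}, (fun i => e (i + 1)) = s → e = consDigit (e 0) s := by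
      rintro s rfl
      ext i
      cases i <;> rfl
    rcases Nat.lt_trichotomy (e 0) 1 with h0 | h0 | h0
    · right
      have h0' : e 0 = 0 := by omega
      rw [h0'] at hev
      push_cast at hev
      have := hcons ((mem_Uq'_iff.1 hd').2 _ (fun i => he.1 _) (by linarith))
      rwa [h0'] at this
    · left
      rw [h0] at hev
      push_cast at hev
      have := hcons ((mem_Uq'_iff.1 hc).2 _ (fun i => he.1 _) (by linarith))
      rwa [h0] at this
    · exfalso
      have h1 : (2 : ℝ) ≤ e 0 := by exact_mod_cast h0
      linarith [expVal_nonneg hp (fun i => e (i + 1))]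

/-- A sequence bounded above with `w (n+1) ≥ s w n - M` satisfies `w 0 ≤ M / (s - 1)`. -/
lemma le_div_of_recurrence {s M B : ℝ} (hs : 1 < s) {w : ℕ → ℝ}
    (hw : ∀ n, s * w n - M ≤ w (n + 1)) (hB : ∀ n, w n ≤ B) : w 0 ≤ M / (s - 1) := by
  by_contra! hlt
  have hs1 : 0 < s - 1 := by linarith
  have hK : s * (M / (s - 1)) - M = M / (s - 1) := by field_simp; ring
  have hgrow : ∀ n, M / (s - 1) + s ^ n * (w 0 - M / (s - 1)) ≤ w n := by
    intro n
    induction n with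
    | zero => simp
    | succ n ih =>
      have := mul_le_mul_of_nonneg_left ih (by linarith : 0 ≤ s)
      rw [pow_succ]
      linarith [hw n]
  obtain ⟨n, hn⟩ := pow_unbounded_of_one_lt ((B - M / (s - 1)) / (w 0 - M / (s - 1))) hs
  rw [div_lt_iff₀ (by linarith)] at hn
  linarith [hgrow n, hB n]

lemma zero_unique {m : ℕ} {p s : ℝ} (hp : 1 < p) (hps : p < s) {c d : ℕ → ℕ}
    (hc : ∀ i, c i ≤ m) (hd : ∀ i, d i ≤ m)
    (hzp : 1 + expVal p c + expVal p d - m / (p - 1) = 0)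
    (hzs : 1 + expVal s c + expVal s d - m / (s - 1) = 0)
    (hlarge : m / (p - 1) / (s - 1) < s + (p - m + c 0 + d 0)) : False := by
  have hs : 1 < s := hp.trans hps
  let T : ℝ → ℕ → ℝ := fun t n =>
    m / (t - 1) - expVal t (fun i => c (i + n)) - expVal t (fun i => d (i + n))
  have hTrec : ∀ t, 1 < t → ∀ n, T t (n + 1) = t * T t n - (m - c n - d n) := by
    intro t ht n
    have h1 := mul_expVal_shift ht hc n
    have h2 := mul_expVal_shift ht hd n
    have ht1 : t - 1 ≠ 0 := by linarith
    have h3 : t * ((m : ℝ) / (t - 1)) = m + m / (t - 1) := by field_simp; ring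
    simp only [T]
    linarith
  have hTlb : ∀ t, 1 < t → ∀ n, -((m : ℝ) / (t - 1)) ≤ T t n := by
    intro t ht n
    have h1 := expVal_le ht (m := m) (c := fun i => c (i + n)) fun i => hc _
    have h2 := expVal_le ht (m := m) (c := fun i => d (i + n)) fun i => hd _
    simp only [T]
    linarith
  have hTub : ∀ t, 1 < t → ∀ n, T t n ≤ m / (t - 1) := by
    intro t ht n
    have h1 := expVal_nonneg ht (fun i => c (i + n))
    have h2 := expVal_nonneg ht (fun i => d (i + n))
    simp only [T]
    linarith
  have hsp : 0 < s - p := by linarith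
  let w : ℕ → ℝ := fun n => (T s n - T p n) / (s - p)
  have hw : ∀ n, w (n + 1) = s * w n + T p n := by
    intro n
    simp only [w]
    rw [hTrec s hs, hTrec p hp]
    field_simp
    ring
  have hTp0 : T p 0 = 1 := by change m / (p - 1) - expVal p c - expVal p d = 1; linarith
  have hTs0 : T s 0 = 1 := by change m / (s - 1) - expVal s c - expVal s d = 1; linarith
  have hw0 : w 0 = 0 := by simp [w, hTp0, hTs0]
  have hw2 : w 2 = s + (p - m + c 0 + d 0) := by
    rw [hw 1, hw 0, hw0, hTrec p hp 0, hTp0]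
    ring
  have := le_div_of_recurrence hs (w := fun n => w (n + 2)) (M := m / (p - 1))
    (B := (m / (s - 1) + m / (p - 1)) / (s - p))
    (fun n => by
      have h1 := hw (n + 2)
      have h2 := hTlb p hp (n + 2)
      change s * w (n + 2) - m / (p - 1) ≤ w (n + 2 + 1)
      linarith)
    (fun n => by
      have h1 := hTub s hs (n + 2)
      have h2 := hTlb p hp (n + 2)
      simp only [w]
      gcongr
      linarith)
  simp only [zero_add] at this
  linarith

lemma isQf_lower_bound {m : ℕ} (hm : 0 < m) {x : ℝ} (hx : isQf m x) :
    (m = 1 ∧ 17 / 10 ≤ x) ∨ 2 ≤ x := by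
  rcases hx with ⟨k, rfl, h, -⟩ | ⟨k, rfl, -, hmax⟩
  · rcases Nat.eq_zero_or_pos k with rfl | hk
    · left
      refine ⟨rfl, ?_⟩
      push_cast at h
      by_contra! hlt
      rcases le_or_gt x 1 with h1 | h1
      · rcases le_or_gt x 0 with h2 | h2
        · nlinarith [mul_nonneg (neg_nonneg.2 h2) (sq_nonneg (x - 1))]
        · nlinarith [mul_pos h2 h2, mul_nonneg (mul_nonneg h2.le h2.le) (sub_nonneg.2 h1)]
      · have h2 : (x - 1) ^ 2 < (7 / 10) ^ 2 := by
          apply pow_lt_pow_left₀ <;> linarith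
        nlinarith [mul_pos (sub_pos.2 hlt) (sub_pos.2 h2)]
    · right
      have hk1 : (1 : ℝ) ≤ k := by exact_mod_cast hk
      by_contra! hlt
      nlinarith [mul_nonneg (sq_nonneg x) (by linarith : 0 ≤ (k : ℝ) + 2 - x)]
  · right
    have hk1 : (1 : ℝ) ≤ k := by
      have : 1 ≤ k := by omega
      exact_mod_cast this
    have hD : 0 ≤ ((k : ℝ) + 1) ^ 2 + 4 * k := by positivity
    have hroot := hmax (((k : ℝ) + 1 + Real.sqrt (((k : ℝ) + 1) ^ 2 + 4 * k)) / 2) (by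
      nlinarith [Real.sq_sqrt hD])
    have hsq : (k : ℝ) + 1 ≤ Real.sqrt (((k : ℝ) + 1) ^ 2 + 4 * k) :=
      Real.le_sqrt_of_sq_le (by linarith)
    linarith

/-- If `f_{c,d}(q) ≤ 0` with `q ∈ [q_f(m), m+1]` and
`c, d ∈ A'_q`, then `f_{c,d}` has a unique zero `q_{c,d}` in `[q, m+1]`,
and `q_{c,d} ∈ B_2(m)`. -/
theorem stmt10 (m : ℕ) (hm : 0 < m) (qf : ℝ) (hqf : isQf m qf)
    (q : ℝ) (hq : q ∈ Set.Icc qf ((m : ℝ) + 1))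
    (c d : ℕ → ℕ) (hc : c ∈ Aq' m q) (hd : d ∈ Aq' m q)
    (h0 : fcd m c d q ≤ 0) :
    ∃ p, (p ∈ Set.Icc q ((m : ℝ) + 1) ∧ fcd m c d p = 0 ∧ p ∈ B2 m) ∧
      ∀ p', p' ∈ Set.Icc q ((m : ℝ) + 1) → fcd m c d p' = 0 → p' = p := by
  obtain ⟨hq1, hqm⟩ := hq
  have hlow := isQf_lower_bound hm hqf
  have hq : 1 < q := by
    rcases hlow with ⟨-, h⟩ | h <;> linarith
  have hcm : ∀ i, c i ≤ m := hc.1.1.1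
  have hdm : ∀ i, d i ≤ m := hd.1.1.1
  have hzero : ∀ t, q ≤ t → (fcd m c d t = 0 ↔ 1 + expVal t c + expVal t d - m / (t - 1) = 0) :=
    fun t ht => fcd_eq_zero_iff (hq.trans_le ht) hcm hdm
  obtain ⟨p, hp, hpz⟩ : ∃ p ∈ Set.Icc q ((m : ℝ) + 1),
      1 + expVal p c + expVal p d - m / (p - 1) = 0 := by
    have hcont : ContinuousOn (fun t => 1 + expVal t c + expVal t d - m / (t - 1))
        (Set.Icc q ((m : ℝ) + 1)) := by
      have h1 := (continuousOn_expVal hq hcm).mono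
        (Set.Icc_subset_Ici_self : Set.Icc q ((m : ℝ) + 1) ⊆ _)
      have h2 := (continuousOn_expVal hq hdm).mono
        (Set.Icc_subset_Ici_self : Set.Icc q ((m : ℝ) + 1) ⊆ _)
      refine ((continuousOn_const.add h1).add h2).sub
        (continuousOn_const.div (by fun_prop) fun t ht => ?_)
      linarith [ht.1]
    have hm0 : (0 : ℝ) < m := by exact_mod_cast hm
    refine intermediate_value_Icc hqm hcont ⟨?_, ?_⟩
    · have h := mul_fcd hq hcm hdm
      have := mul_nonpos_of_nonneg_of_nonpos (by linarith : 0 ≤ q) h0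
      linarith
    · have h1 := expVal_nonneg (by linarith : 1 < (m : ℝ) + 1) c
      have h2 := expVal_nonneg (by linarith : 1 < (m : ℝ) + 1) d
      have h3 : (m : ℝ) / (m + 1 - 1) = 1 := by rw [add_sub_cancel_right, div_self hm0.ne']
      simp only [h3]
      linarith
  have huniq : ∀ p s, q ≤ p → p < s → s ≤ m + 1 → 1 + expVal p c + expVal p d - m / (p - 1) = 0 →
      1 + expVal s c + expVal s d - m / (s - 1) = 0 → False := by
    intro p s hqp hps hsm hzp hzs
    have hp1 : 1 < p := hq.trans_le hqp
    refine zero_unique hp1 hps hcm hdm hzp hzs ?_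
    rcases hlow with ⟨rfl, h⟩ | h
    · have hp7 : 7 / 10 ≤ p - 1 := by linarith
      have h1 : ((1 : ℕ) : ℝ) / (p - 1) / (s - 1) ≤ 1 / (7 / 10) / (7 / 10) := by
        push_cast
        gcongr
        linarith
      have h2 : (0 : ℝ) ≤ c 0 := Nat.cast_nonneg _
      have h3 : (0 : ℝ) ≤ d 0 := Nat.cast_nonneg _
      have h4 : (1 : ℝ) / (7 / 10) / (7 / 10) < 17 / 10 + 7 / 10 := by norm_num
      have h5 : ((1 : ℕ) : ℝ) = 1 := Nat.cast_one
      linarith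
    · have hpm : p ≤ m + 1 := by linarith
      have htail : ∀ e ∈ Aq' m q, expVal p (fun i => e (i + 1)) < 1 := by
        intro e he
        have h0 := first_digit_lt_of_mem_Aq' hq hqm he
        have h0m : e 0 < m := by
          have : (e 0 : ℝ) < m := by linarith
          exact_mod_cast this
        exact expVal_tail_lt_one hp1 hpm (Uq'_mono hq hqp hpm he.1) h0m
      have h1 := mul_expVal hp1 hcm
      have h2 := mul_expVal hp1 hdm
      have h3 := htail c hc
      have h4 := htail d hd
      have hpne : p - 1 ≠ 0 := by linarith
      have h5 : p * ((m : ℝ) / (p - 1)) = m + m / (p - 1) := by field_simp; ring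
      have h6 : (0 : ℝ) ≤ m / (p - 1) := div_nonneg (Nat.cast_nonneg _) (by linarith)
      have h7 : (m : ℝ) / (p - 1) / (s - 1) ≤ m / (p - 1) := div_le_self h6 (by linarith)
      have h8 : p * (1 + expVal p c + expVal p d - m / (p - 1)) = 0 := by rw [hzp, mul_zero]
      linarith
  refine ⟨p, ⟨hp, (hzero p hp.1).2 hpz, ?_⟩, fun s hs hsz => ?_⟩
  · exact mem_B2_of_zero hm (hq.trans_le hp.1) hp.2 (Uq'_mono hq hp.1 hp.2 hc.1)
      (Uq'_mono hq hp.1 hp.2 hd.1)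
      ((expVal_antitone hq hp.1 hcm).trans_lt (expVal_lt_one_of_mem_Aq' hq hqm hc)) hpz
  · rw [hzero s hs.1] at hsz
    rcases lt_trichotomy s p with h | h | h
    · exact (huniq s p hs.1 h hp.2 hsz hpz).elim
    · exact h
    · exact (huniq p s hp.1 h hs.2 hpz hsz).elim
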